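/- Let X be a nontrivial real Banach space. Then for every t ≥ 0, E_I(t, X) = E(t, X). -/

import Mathlib

noncomputable section

/-- Isosceles orthogonality: `x ⊥_I y` iff `‖x + y‖ = ‖x - y‖`. -/
def IsoOrth {X : Type*} [NormedAddCommGroup X] (x y : X) : Prop := ‖x + y‖ = ‖x - y‖

variable (X : Type*) [NormedAddCommGroup X] [NormedSpace ℝ X]

/-- The constant `H̃(X)`. -/
def Htilde : ℝ :=
  sSup {r : ℝ | ∃ x y : X, (x, y) ≠ (0, 0) ∧ IsoOrth x y ∧ r = (‖x‖ + ‖y‖) / ‖x + y‖}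

/-- The constant `A₂(X)`. -/
def A2 : ℝ :=
  sSup {r : ℝ | ∃ x y : X, ‖x‖ = 1 ∧ ‖y‖ = 1 ∧ r = (‖x + y‖ + ‖x - y‖) / 2}

/-- Clarkson's modulus of convexity `δ_X(ε)`. -/
def modulusConvexity (ε : ℝ) : ℝ :=
  sInf {r : ℝ | ∃ x y : X, ‖x‖ ≤ 1 ∧ ‖y‖ ≤ 1 ∧ ε ≤ ‖x - y‖ ∧ r = 1 - ‖x + y‖ / 2}

/-- The constant `H̃²(X)`. -/
def HtildeSq : ℝ :=
  sSup {r : ℝ | ∃ x y : X, (x, y) ≠ (0, 0) ∧ IsoOrth x y ∧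
    r = (‖x‖ ^ 2 + ‖y‖ ^ 2) / ‖x + y‖ ^ 2}

/-- The modified von Neumann–Jordan constant `C′_NJ(X)`. -/
def CNJmod : ℝ :=
  sSup {r : ℝ | ∃ x y : X, ‖x‖ = 1 ∧ ‖y‖ = 1 ∧ r = (‖x + y‖ ^ 2 + ‖x - y‖ ^ 2) / 4}

/-- The von Neumann–Jordan constant `C_NJ(X)`. -/
def CNJ : ℝ :=
  sSup {r : ℝ | ∃ x y : X, (x, y) ≠ (0, 0) ∧
    r = (‖x + y‖ ^ 2 + ‖x - y‖ ^ 2) / (2 * ‖x‖ ^ 2 + 2 * ‖y‖ ^ 2)}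

/-- The James constant in its isosceles-orthogonality form. -/
def JamesConst : ℝ :=
  sSup {r : ℝ | ∃ x y : X, ‖x‖ ≤ 1 ∧ ‖y‖ ≤ 1 ∧ IsoOrth x y ∧ r = ‖x + y‖}

/-- The constant `E_I(t, X)`. -/
def EI (t : ℝ) : ℝ :=
  sSup {r : ℝ | ∃ x y : X, (x, y) ≠ (0, 0) ∧ IsoOrth x y ∧
    r = (‖(t + 1) • x + (1 - t) • y‖ ^ 2 + ‖(1 - t) • x - (t + 1) • y‖ ^ 2) / ‖x + y‖ ^ 2}

/-- The skew constant `E(t, X)`. -/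
def Eskew (t : ℝ) : ℝ :=
  sSup {r : ℝ | ∃ x y : X, ‖x‖ = 1 ∧ ‖y‖ = 1 ∧ r = ‖x + t • y‖ ^ 2 + ‖t • x - y‖ ^ 2}

/-- The constant `L^I_YJ(τ, υ, X)`. -/
def LIYJ (τ υ : ℝ) : ℝ :=
  sSup {r : ℝ | ∃ x y : X, (x, y) ≠ (0, 0) ∧ IsoOrth x y ∧
    r = (‖(τ + υ) • x + (υ - τ) • y‖ ^ 2 + ‖(υ - τ) • x - (τ + υ) • y‖ ^ 2) /
      (υ ^ 2 * ‖x + y‖ ^ 2)}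

/-- The modified skew von Neumann–Jordan constant `L′_YJ(τ, υ, X)`. -/
def LYJmod (τ υ : ℝ) : ℝ :=
  sSup {r : ℝ | ∃ x y : X, ‖x‖ = 1 ∧ ‖y‖ = 1 ∧
    r = (‖τ • x + υ • y‖ ^ 2 + ‖υ • x - τ • y‖ ^ 2) / (2 * (τ ^ 2 + υ ^ 2))}

end

/-- The linear change of variables `a = x + y`, `b = x - y` turns the numerator of `EI` into that
of `Eskew`. -/
theorem norm_sq_add_norm_sq_eq_skew {X : Type*} [NormedAddCommGroup X] [NormedSpace ℝ X]
    (t : ℝ) (x y : X) :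
    ‖(t + 1) • x + (1 - t) • y‖ ^ 2 + ‖(1 - t) • x - (t + 1) • y‖ ^ 2 =
      ‖(x + y) + t • (x - y)‖ ^ 2 + ‖t • (x + y) - (x - y)‖ ^ 2 := by
  have h₁ : (t + 1) • x + (1 - t) • y = (x + y) + t • (x - y) := by module
  have h₂ : (1 - t) • x - (t + 1) • y = -(t • (x + y) - (x - y)) := by module
  rw [h₁, h₂, norm_neg]

/-- `E_I(t, X) = E(t, X)` for every `t ≥ 0`. -/
theorem stmt14 (X : Type*) [NormedAddCommGroup X] [NormedSpace ℝ X] [CompleteSpace X]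
    [Nontrivial X] :
    ∀ t : ℝ, 0 ≤ t → EI X t = Eskew X t := by
  intro t _
  unfold EI Eskew
  congr 1
  ext r
  constructor
  · rintro ⟨x, y, hxy, hiso, rfl⟩
    have hsub : ‖x - y‖ = ‖x + y‖ := hiso.symm
    have hne : ‖x + y‖ ≠ 0 := by
      intro h
      have hadd : x + y = 0 := norm_eq_zero.mp h
      have hdiff : x - y = 0 := norm_eq_zero.mp (hsub.trans h)
      have hx : x = (2⁻¹ : ℝ) • ((x + y) + (x - y)) := by module
      have hy : y = (2⁻¹ : ℝ) • ((x + y) - (x - y)) := by module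
      rw [hadd, hdiff] at hx hy
      exact hxy (by simpa using And.intro hx hy)
    refine ⟨‖x + y‖⁻¹ • (x + y), ‖x + y‖⁻¹ • (x - y), ?_, ?_, ?_⟩
    · rw [norm_smul, norm_inv, norm_norm, inv_mul_cancel₀ hne]
    · rw [norm_smul, norm_inv, norm_norm, hsub, inv_mul_cancel₀ hne]
    · rw [norm_sq_add_norm_sq_eq_skew, smul_comm t, smul_comm t, ← smul_add, ← smul_sub,
        norm_smul, norm_smul, norm_inv, norm_norm]
      field_simp
  · rintro ⟨a, b, ha, hb, rfl⟩
    have hadd : (2⁻¹ : ℝ) • (a + b) + (2⁻¹ : ℝ) • (a - b) = a := by module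
    have hsub : (2⁻¹ : ℝ) • (a + b) - (2⁻¹ : ℝ) • (a - b) = b := by module
    refine ⟨(2⁻¹ : ℝ) • (a + b), (2⁻¹ : ℝ) • (a - b), ?_, ?_, ?_⟩
    · intro h
      rw [Prod.mk.injEq] at h
      rw [h.1, h.2, add_zero] at hadd
      simp [← hadd] at ha
    · rw [IsoOrth, hadd, hsub, ha, hb]
    · rw [norm_sq_add_norm_sq_eq_skew, hadd, hsub, ha, one_pow, div_one]
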